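/- Let 0 < λ < 1 and n ≥ 1, and let a : ℤ → (0,∞) be an n-periodic sequence (a_{i+n} = a_i for all i) with ∏_{i=0}^{n-1} a_i < λⁿ. Then there exists m ∈ ℤ that is a forward λ-good index for a, i.e., ∏_{i=0}^{k-1} a_{m+i} ≤ λ^k for every k ≥ 1. -/

import Mathlib

/-- Pliss-type lemma for periodic sequences: if `a` is `n`-periodic and positive with
`∏_{i<n} a i < λⁿ`, then some index `m` is a forward `λ`-good index for `a`. -/
theorem exists_forward_good_index (lam : ℝ) (hlam0 : 0 < lam) (hlam1 : lam < 1)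
    (n : ℕ) (hn : 1 ≤ n) (a : ℤ → ℝ) (ha : ∀ i : ℤ, 0 < a i)
    (hap : ∀ i : ℤ, a (i + n) = a i)
    (hprod : ∏ i ∈ Finset.range n, a i < lam ^ n) :
    ∃ m : ℤ, ∀ k : ℕ, 1 ≤ k → ∏ i ∈ Finset.range k, a (m + i) ≤ lam ^ k := by
  set P : ℕ → ℝ := fun j => ∏ i ∈ Finset.range j, (a i / lam) with hP
  have hpos : ∀ j, 0 < P j := fun j => Finset.prod_pos fun i _ => div_pos (ha i) hlam0
  have hPn : P n ≤ 1 := by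
    simp only [hP, Finset.prod_div_distrib, Finset.prod_const, Finset.card_range]
    exact (div_le_one (pow_pos hlam0 n)).2 hprod.le
  have hstep : ∀ j, P (n + j) ≤ P j := by
    intro j
    have h : P (n + j) = P n * P j := by
      simp only [hP, Finset.prod_range_add]
      congr 1
      refine Finset.prod_congr rfl fun i _ => ?_
      rw [← hap i]
      push_cast
      rw [add_comm]
    rw [h]
    exact mul_le_of_le_one_left (hpos j).le hPn
  obtain ⟨m, -, hm⟩ := Finset.exists_max_image (Finset.range n) P ⟨0, by simp; omega⟩
  have hmax : ∀ j, P j ≤ P m := by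
    intro j
    induction j using Nat.strong_induction_on with
    | _ j ih =>
      by_cases hj : j < n
      · exact hm j (Finset.mem_range.2 hj)
      · have h1 := hstep (j - n)
        rw [Nat.add_sub_cancel' (not_lt.1 hj)] at h1
        exact h1.trans (ih (j - n) (by omega))
  refine ⟨m, fun k _ => ?_⟩
  have h : P (m + k) = P m * ((∏ i ∈ Finset.range k, a (m + i)) / lam ^ k) := by
    simp only [hP, Finset.prod_range_add]
    congr 1
    simp [Finset.prod_div_distrib]
  have h2 := hmax (m + k)
  rw [h] at h2
  exact (div_le_one (pow_pos hlam0 k)).1 ((mul_le_iff_le_one_right (hpos m)).1 h2)
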